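/- Let N, M ≥ 1, let q ∈ ℂ with 0 < |q| < 1, and let a_1,…,a_N, b_1,…,b_M, c_1,…,c_N ∈ ℂ with c_j ∉ {q^{−n} : n ∈ ℕ} for every j. Let F : {y ∈ ℂ^M : |y_i| < 1 ∀i} → ℂ be defined by F(y) = F_{N,M}({a_j},{b_i};{c_j};{y_i}). For 1 ≤ s ≤ M let T_{y_s} be the operator replacing y_s by q y_s, and T = T_{y_1} T_{y_2} ⋯ T_{y_M}. Then for every s with 1 ≤ s ≤ M and every y in the open unit polydisc, [ ∏_{j=1}^N (1 − c_j q^{−1} T) · (1 − T_{y_s}) − y_s ∏_{j=1}^N (1 − a_j T) · (1 − b_s T_{y_s}) ] F(y) = 0, where the products of the commuting shift operators are expanded in the usual way and y_s denotes multiplication by the coordinate y_s. -/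

import Mathlib

/-- The infinite q-Pochhammer symbol `(a;q)_∞ = ∏_{i=0}^∞ (1 - q^i a)`. -/
noncomputable def qPochInf (q a : ℂ) : ℂ := ∏' i : ℕ, (1 - q ^ i * a)

/-- The q-Pochhammer symbol `(a;q)_n = (a;q)_∞ / (q^n a;q)_∞`. -/
noncomputable def qPochRat (q a : ℂ) (n : ℕ) : ℂ :=
  qPochInf q a / qPochInf q (q ^ n * a)

/-- The generalized q-hypergeometric series `F_{N,M}` as a function of `y`. -/
noncomputable def Fqhyp (q : ℂ) {N M : ℕ} (a : Fin N → ℂ) (b : Fin M → ℂ)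
    (c : Fin N → ℂ) (y : Fin M → ℂ) : ℂ :=
  ∑' m : Fin M → ℕ,
    (∏ j : Fin N, qPochRat q (a j) (∑ i, m i) / qPochRat q (c j) (∑ i, m i)) *
    (∏ i : Fin M, qPochRat q (b i) (m i) / qPochRat q q (m i)) *
    ∏ i : Fin M, y i ^ m i

/-- Composition of a list of operators on functions `(Fin M → ℂ) → ℂ`
(the operators in question commute, so the order is immaterial). -/
def OpProd {α : Type*} (l : List ((α → ℂ) → (α → ℂ))) : (α → ℂ) → (α → ℂ) :=
  l.foldr (· ∘ ·) id

open Filter Topology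

theorem multipliable_one_sub_pow_mul {q : ℂ} (hq1 : ‖q‖ < 1) (a : ℂ) :
    Multipliable fun i : ℕ => 1 - q ^ i * a := by
  simpa only [sub_eq_add_neg] using
    multipliable_one_add_of_summable (f := fun i : ℕ => -(q ^ i * a)) (by
      simpa [norm_mul, norm_pow] using
        (summable_geometric_of_lt_one (norm_nonneg q) hq1).mul_right ‖a‖)

theorem prod_range_mul_qPochInf {q : ℂ} (hq1 : ‖q‖ < 1) (a : ℂ) (n : ℕ) :
    (∏ i ∈ Finset.range n, (1 - q ^ i * a)) * qPochInf q (q ^ n * a) = qPochInf q a := by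
  have h : (fun i : ℕ => 1 - q ^ i * (q ^ n * a)) = fun i => 1 - q ^ (i + n) * a := by
    funext i
    ring
  have hm := multipliable_one_sub_pow_mul hq1 (q ^ n * a)
  rw [h] at hm
  rw [qPochInf, h]
  exact Multipliable.prod_mul_tprod_nat_mul' (f := fun i : ℕ => 1 - q ^ i * a) hm

theorem qPochRat_of_eq_zero {q a : ℂ} (h : qPochInf q a = 0) (n : ℕ) : qPochRat q a n = 0 := by
  simp [qPochRat, h]

theorem qPochRat_eq_prod_range {q a : ℂ} (hq1 : ‖q‖ < 1) (h : qPochInf q a ≠ 0) (n : ℕ) :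
    qPochRat q a n = ∏ i ∈ Finset.range n, (1 - q ^ i * a) := by
  have hn := prod_range_mul_qPochInf hq1 a n
  have h0 : qPochInf q (q ^ n * a) ≠ 0 := by
    intro h'
    exact h (by rw [← hn, h', mul_zero])
  rw [qPochRat, ← hn, mul_div_cancel_right₀ _ h0]

theorem one_sub_pow_mul_ne_zero {q a : ℂ} (hq1 : ‖q‖ < 1) (h : qPochInf q a ≠ 0) (n : ℕ) :
    1 - q ^ n * a ≠ 0 := by
  intro h'
  apply h
  rw [← prod_range_mul_qPochInf hq1 a (n + 1), Finset.prod_range_succ, h', mul_zero, zero_mul]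

theorem qPochRat_succ {q : ℂ} (hq1 : ‖q‖ < 1) (a : ℂ) (n : ℕ) :
    qPochRat q a (n + 1) = (1 - q ^ n * a) * qPochRat q a n := by
  by_cases h : qPochInf q a = 0
  · simp [qPochRat_of_eq_zero h]
  · rw [qPochRat_eq_prod_range hq1 h, qPochRat_eq_prod_range hq1 h, Finset.prod_range_succ,
      mul_comm]

theorem mul_inv_qPochRat_succ {q : ℂ} (hq1 : ‖q‖ < 1) (a : ℂ) (n : ℕ) :
    (1 - q ^ n * a) * (qPochRat q a (n + 1))⁻¹ = (qPochRat q a n)⁻¹ := by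
  by_cases h : qPochInf q a = 0
  · simp [qPochRat_of_eq_zero h]
  · rw [qPochRat_succ hq1, mul_inv, mul_inv_cancel_left₀ (one_sub_pow_mul_ne_zero hq1 h n)]

theorem tendsto_qPochRat {q : ℂ} (hq1 : ‖q‖ < 1) (a : ℂ) :
    Tendsto (qPochRat q a) atTop (𝓝 (qPochInf q a)) := by
  by_cases h : qPochInf q a = 0
  · rw [funext (qPochRat_of_eq_zero h), h]
    exact tendsto_const_nhds
  · rw [funext (qPochRat_eq_prod_range hq1 h)]
    exact (multipliable_one_sub_pow_mul hq1 a).hasProd.tendsto_prod_nat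

theorem tendsto_inv_qPochRat {q : ℂ} (hq1 : ‖q‖ < 1) (a : ℂ) :
    Tendsto (fun n => (qPochRat q a n)⁻¹) atTop (𝓝 (qPochInf q a)⁻¹) := by
  by_cases h : qPochInf q a = 0
  · simp [qPochRat_of_eq_zero h, h]
  · exact (tendsto_qPochRat hq1 a).inv₀ h

/-- A complex-valued function is bounded in norm. -/
def NormBounded {α : Type*} (f : α → ℂ) : Prop := ∃ C, ∀ x, ‖f x‖ ≤ C

namespace NormBounded

variable {α β : Type*} {f g : α → ℂ}

theorem const (k : ℂ) : NormBounded fun _ : α => k := ⟨‖k‖, fun _ => le_rfl⟩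

theorem mul (hf : NormBounded f) (hg : NormBounded g) : NormBounded fun x => f x * g x := by
  obtain ⟨C, hC⟩ := hf
  obtain ⟨D, hD⟩ := hg
  refine ⟨C * D, fun x => ?_⟩
  rw [norm_mul]
  exact mul_le_mul (hC x) (hD x) (norm_nonneg _) ((norm_nonneg _).trans (hC x))

theorem sub (hf : NormBounded f) (hg : NormBounded g) : NormBounded fun x => f x - g x := by
  obtain ⟨C, hC⟩ := hf
  obtain ⟨D, hD⟩ := hg
  exact ⟨C + D, fun x => (norm_sub_le _ _).trans (add_le_add (hC x) (hD x))⟩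

theorem comp (hf : NormBounded f) (u : β → α) : NormBounded fun x => f (u x) :=
  let ⟨C, hC⟩ := hf
  ⟨C, fun x => hC (u x)⟩

theorem prod {ι : Type*} (t : Finset ι) {F : ι → α → ℂ} (h : ∀ i, NormBounded (F i)) :
    NormBounded fun x => ∏ i ∈ t, F i x := by
  classical
  induction t using Finset.induction_on with
  | empty => simpa using const (α := α) 1
  | insert i t hi ih => simpa only [Finset.prod_insert hi] using (h i).mul ih

theorem of_tendsto {u : ℕ → ℂ} {l : ℂ} (h : Tendsto u atTop (𝓝 l)) : NormBounded u := by
  obtain ⟨C, hC⟩ := (Metric.isBounded_range_of_tendsto u h).exists_norm_le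
  exact ⟨C, fun n => hC _ ⟨n, rfl⟩⟩

theorem pow {q : ℂ} (hq1 : ‖q‖ < 1) : NormBounded fun n : ℕ => q ^ n :=
  of_tendsto (tendsto_pow_atTop_nhds_zero_of_norm_lt_one hq1)

end NormBounded

theorem summable_prod_pow : ∀ {M : ℕ} (r : Fin M → ℝ), (∀ i, 0 ≤ r i) → (∀ i, r i < 1) →
    Summable fun m : Fin M → ℕ => ∏ i, r i ^ m i
  | 0, _, _, _ => Summable.of_finite
  | M + 1, r, h0, h1 => by
    rw [← (Fin.consEquiv fun _ : Fin (M + 1) => ℕ).summable_iff]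
    have := (summable_geometric_of_lt_one (h0 0) (h1 0)).mul_of_nonneg
      (summable_prod_pow (fun i => r i.succ) (fun i => h0 _) (fun i => h1 _))
      (fun n => pow_nonneg (h0 0) n) (fun m => Finset.prod_nonneg fun i _ => pow_nonneg (h0 _) _)
    refine this.congr fun x => ?_
    simp [Fin.consEquiv, Fin.prod_univ_succ]

/-- The sum of the power series in `M` variables with coefficients `A`. -/
noncomputable def multiPowerSum {M : ℕ} (A : (Fin M → ℕ) → ℂ) (y : Fin M → ℂ) : ℂ :=
  ∑' m : Fin M → ℕ, A m * ∏ i, y i ^ m i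

section multiPowerSum

variable {M : ℕ} {A B : (Fin M → ℕ) → ℂ} {y : Fin M → ℂ} {q : ℂ}

theorem NormBounded.summable_mul_prod_pow (hA : NormBounded A) (hy : ∀ i, ‖y i‖ < 1) :
    Summable fun m : Fin M → ℕ => A m * ∏ i, y i ^ m i := by
  obtain ⟨C, hC⟩ := hA
  refine Summable.of_norm_bounded
    ((summable_prod_pow (fun i => ‖y i‖) (fun i => norm_nonneg _) hy).mul_left C) fun m => ?_
  rw [norm_mul, norm_prod]
  simp only [norm_pow]
  exact mul_le_mul_of_nonneg_right (hC m) (Finset.prod_nonneg fun i _ => by positivity)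

theorem multiPowerSum_sub_mul (hA : NormBounded A) (hB : NormBounded B) (hy : ∀ i, ‖y i‖ < 1)
    (k : ℂ) : multiPowerSum A y - k * multiPowerSum B y =
      multiPowerSum (fun m => A m - k * B m) y := by
  rw [multiPowerSum, multiPowerSum, multiPowerSum, ← tsum_mul_left,
    ← (hA.summable_mul_prod_pow hy).tsum_sub ((hB.summable_mul_prod_pow hy).mul_left k)]
  exact tsum_congr fun m => by ring

theorem multiPowerSum_mul_all (A : (Fin M → ℕ) → ℂ) (y : Fin M → ℂ) (q : ℂ) :
    multiPowerSum A (fun i => q * y i) = multiPowerSum (fun m => q ^ (∑ i, m i) * A m) y := by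
  refine tsum_congr fun m => ?_
  simp only [mul_pow, Finset.prod_mul_distrib, Finset.prod_pow_eq_pow_sum]
  ring

theorem multiPowerSum_update (A : (Fin M → ℕ) → ℂ) (y : Fin M → ℂ) (q : ℂ) (s : Fin M) :
    multiPowerSum A (Function.update y s (q * y s)) =
      multiPowerSum (fun m => q ^ m s * A m) y := by
  refine tsum_congr fun m => ?_
  rw [← Finset.mul_prod_erase _ _ (Finset.mem_univ s),
    ← Finset.mul_prod_erase _ (fun i => y i ^ m i) (Finset.mem_univ s), Function.update_self,
    Finset.prod_congr rfl fun i hi => by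
      rw [Function.update_of_ne (Finset.ne_of_mem_erase hi)], mul_pow]
  ring

theorem norm_mul_lt_one_of_lt_one (hq1 : ‖q‖ < 1) (hy : ∀ i, ‖y i‖ < 1) (i : Fin M) :
    ‖q * y i‖ < 1 := by
  rw [norm_mul]
  exact mul_lt_one_of_nonneg_of_lt_one_left (norm_nonneg _) hq1 (hy i).le

theorem NormBounded.list_prod_mul (hA : NormBounded A) (hq1 : ‖q‖ < 1) {ι : Type*} (k : ι → ℂ)
    (l : List ι) :
    NormBounded fun m : Fin M → ℕ => (l.map fun j => 1 - k j * q ^ (∑ i, m i)).prod * A m := by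
  induction l with
  | nil => simpa using hA
  | cons j l ih =>
    simp only [List.map_cons, List.prod_cons, mul_assoc]
    exact ((const 1).sub ((const (k j)).mul ((pow hq1).comp fun m : Fin M → ℕ => ∑ i, m i))).mul ih

theorem OpProd_map_eq_multiPowerSum (hq1 : ‖q‖ < 1) {ι : Type*} (k : ι → ℂ)
    {G : (Fin M → ℂ) → ℂ} (hA : NormBounded A)
    (hG : ∀ y : Fin M → ℂ, (∀ i, ‖y i‖ < 1) → G y = multiPowerSum A y) (l : List ι) :
    ∀ y : Fin M → ℂ, (∀ i, ‖y i‖ < 1) →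
      OpProd (l.map fun j => fun (G : (Fin M → ℂ) → ℂ) (y' : Fin M → ℂ) =>
        G y' - k j * G (fun i => q * y' i)) G y =
      multiPowerSum (fun m => (l.map fun j => 1 - k j * q ^ (∑ i, m i)).prod * A m) y := by
  induction l with
  | nil =>
    intro y hy
    simpa [OpProd] using hG y hy
  | cons j l ih =>
    intro y hy
    have hb := hA.list_prod_mul hq1 k l
    have hq := (NormBounded.pow hq1).comp fun m : Fin M → ℕ => ∑ i, m i
    refine (congrArg₂ (fun u v => u - k j * v) (ih y hy)
      (ih _ (norm_mul_lt_one_of_lt_one hq1 hy))).trans ?_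
    rw [multiPowerSum_mul_all, multiPowerSum_sub_mul hb (hq.mul hb) hy]
    congr 1
    funext m
    rw [List.map_cons, List.prod_cons]
    ring

theorem sum_add_single_one (m : Fin M → ℕ) (s : Fin M) :
    ∑ i, (m + Pi.single s 1 : Fin M → ℕ) i = ∑ i, m i + 1 := by
  simp [Finset.sum_add_distrib]

theorem multiPowerSum_eq_mul_of_shift (s : Fin M) (h0 : ∀ m, m s = 0 → A m = 0)
    (h : ∀ m, A (m + Pi.single s 1) = B m) (y : Fin M → ℂ) :
    multiPowerSum A y = y s * multiPowerSum B y := by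
  have hinj : Function.Injective fun m : Fin M → ℕ => m + Pi.single s 1 :=
    add_left_injective _
  rw [multiPowerSum, multiPowerSum, ← tsum_mul_left, ← hinj.tsum_eq]
  · refine tsum_congr fun m => ?_
    rw [h]
    simp only [Pi.add_apply, pow_add, Finset.prod_mul_distrib]
    have hs : ∏ i, y i ^ (Pi.single s 1 : Fin M → ℕ) i = y s := by
      rw [Finset.prod_eq_single s (fun i _ hi => by rw [Pi.single_eq_of_ne hi, pow_zero])
        (by simp), Pi.single_eq_same, pow_one]
    rw [hs]
    ring
  · intro m hm
    have hs : m s ≠ 0 := fun hs => hm (by simp [h0 m hs])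
    refine ⟨m - Pi.single s 1, ?_⟩
    funext i
    by_cases hi : i = s
    · subst hi
      simp
      omega
    · simp [Pi.single_eq_of_ne hi]

end multiPowerSum

section qHypergeometric

variable {N M : ℕ}

/-- The coefficients of the generalized q-hypergeometric series. -/
noncomputable def qHypCoeff (q : ℂ) (a c : Fin N → ℂ) (b : Fin M → ℂ) (m : Fin M → ℕ) : ℂ :=
  (∏ j : Fin N, qPochRat q (a j) (∑ i, m i) / qPochRat q (c j) (∑ i, m i)) *
    ∏ i : Fin M, qPochRat q (b i) (m i) / qPochRat q q (m i)

theorem NormBounded.qHypCoeff {q : ℂ} (hq1 : ‖q‖ < 1) (a c : Fin N → ℂ) (b : Fin M → ℂ) :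
    NormBounded (qHypCoeff q a c b) := by
  have h (u v : ℂ) : NormBounded fun n => qPochRat q u n / qPochRat q v n := by
    simp only [div_eq_mul_inv]
    exact (of_tendsto (tendsto_qPochRat hq1 u)).mul (of_tendsto (tendsto_inv_qPochRat hq1 v))
  exact (prod _ fun j => (h (a j) (c j)).comp fun m : Fin M → ℕ => ∑ i, m i).mul
    (prod _ fun i => (h (b i) q).comp fun m : Fin M → ℕ => m i)

theorem mul_qPochRat_div_succ {q : ℂ} (hq1 : ‖q‖ < 1) (u v : ℂ) (n : ℕ) :
    (1 - q ^ n * v) * (qPochRat q u (n + 1) / qPochRat q v (n + 1)) =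
      (1 - q ^ n * u) * (qPochRat q u n / qPochRat q v n) := by
  rw [div_eq_mul_inv, div_eq_mul_inv, ← mul_inv_qPochRat_succ hq1 v n, qPochRat_succ hq1 u]
  ring

theorem qHypCoeff_add_single {q : ℂ} (hq1 : ‖q‖ < 1) (a c : Fin N → ℂ) (b : Fin M → ℂ)
    (s : Fin M) (m : Fin M → ℕ) :
    (∏ j, (1 - q ^ (∑ i, m i) * c j)) * ((1 - q ^ (m s + 1)) *
      qHypCoeff q a c b (m + Pi.single s 1)) =
    (∏ j, (1 - q ^ (∑ i, m i) * a j)) * ((1 - q ^ m s * b s) * qHypCoeff q a c b m) := by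
  have hN : (∏ j, (1 - q ^ (∑ i, m i) * c j)) *
      (∏ j, qPochRat q (a j) (∑ i, m i + 1) / qPochRat q (c j) (∑ i, m i + 1)) =
      (∏ j, (1 - q ^ (∑ i, m i) * a j)) *
      ∏ j, qPochRat q (a j) (∑ i, m i) / qPochRat q (c j) (∑ i, m i) := by
    rw [← Finset.prod_mul_distrib, ← Finset.prod_mul_distrib]
    exact Finset.prod_congr rfl fun j _ => mul_qPochRat_div_succ hq1 _ _ _
  have hM : (1 - q ^ (m s + 1)) * (∏ i, qPochRat q (b i) ((m + Pi.single s 1 : Fin M → ℕ) i) /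
      qPochRat q q ((m + Pi.single s 1 : Fin M → ℕ) i)) =
      (1 - q ^ m s * b s) * ∏ i, qPochRat q (b i) (m i) / qPochRat q q (m i) := by
    rw [← Finset.mul_prod_erase _ _ (Finset.mem_univ s),
      ← Finset.mul_prod_erase _ (fun i => qPochRat q (b i) (m i) / qPochRat q q (m i))
        (Finset.mem_univ s),
      Finset.prod_congr rfl fun i hi => by
        rw [Pi.add_apply, Pi.single_eq_of_ne (Finset.ne_of_mem_erase hi), add_zero],
      Pi.add_apply, Pi.single_eq_same, ← mul_assoc, ← mul_assoc, pow_succ,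
      mul_qPochRat_div_succ hq1]
  rw [qHypCoeff, qHypCoeff, sum_add_single_one]
  linear_combination (1 - q ^ (m s + 1)) * (∏ i, qPochRat q (b i) ((m + Pi.single s 1 : Fin M → ℕ) i) /
      qPochRat q q ((m + Pi.single s 1 : Fin M → ℕ) i)) * hN + (∏ j, (1 - q ^ (∑ i, m i) * a j)) *
      (∏ j, qPochRat q (a j) (∑ i, m i) / qPochRat q (c j) (∑ i, m i)) * hM

/-- The function `(1 - k T_{y_s}) F` is given on the polydisc by its power series. -/
theorem Fqhyp_sub_mul_update {q : ℂ} (hq1 : ‖q‖ < 1) (a c : Fin N → ℂ) (b : Fin M → ℂ)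
    (s : Fin M) (k : ℂ) {y : Fin M → ℂ} (hy : ∀ i, ‖y i‖ < 1) :
    Fqhyp q a b c y - k * Fqhyp q a b c (Function.update y s (q * y s)) =
      multiPowerSum (fun m => (1 - k * q ^ m s) * qHypCoeff q a c b m) y := by
  have hF : Fqhyp q a b c = multiPowerSum (qHypCoeff q a c b) := rfl
  have hA := NormBounded.qHypCoeff hq1 a c b
  rw [hF, multiPowerSum_update,
    multiPowerSum_sub_mul hA (((NormBounded.pow hq1).comp fun m : Fin M → ℕ => m s).mul hA) hy]
  congr 1
  funext m
  ring

theorem NormBounded.one_sub_mul_qHypCoeff {q : ℂ} (hq1 : ‖q‖ < 1) (a c : Fin N → ℂ)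
    (b : Fin M → ℂ) (s : Fin M) (k : ℂ) :
    NormBounded fun m : Fin M → ℕ => (1 - k * q ^ m s) * _root_.qHypCoeff q a c b m :=
  ((const 1).sub ((const k).mul ((pow hq1).comp fun m : Fin M → ℕ => m s))).mul
    (NormBounded.qHypCoeff hq1 a c b)

end qHypergeometric

/-- the q-difference equations
`[ ∏_j (1 − c_j q^{−1} T)·(1 − T_{y_s}) − y_s ∏_j (1 − a_j T)·(1 − b_s T_{y_s}) ] F = 0`
satisfied by `F_{N,M}` on the open unit polydisc, where `T_{y_s}` replaces
`y_s` by `q y_s` and `T = T_{y_1} ⋯ T_{y_M}`. -/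
theorem stmt3 (N M : ℕ) (hN : 1 ≤ N) (hM : 1 ≤ M) (q : ℂ)
    (hq0 : 0 < ‖q‖) (hq1 : ‖q‖ < 1)
    (a c : Fin N → ℂ) (b : Fin M → ℂ)
    (hc : ∀ j : Fin N, ∀ n : ℕ, c j ≠ q ^ (-(n : ℤ)))
    (s : Fin M) (y : Fin M → ℂ) (hy : ∀ i, ‖y i‖ < 1) :
    OpProd ((List.finRange N).map (fun j =>
        fun (G : (Fin M → ℂ) → ℂ) (y' : Fin M → ℂ) =>
          G y' - c j * q⁻¹ * G (fun i => q * y' i)))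
      (fun y' => Fqhyp q a b c y' -
        Fqhyp q a b c (Function.update y' s (q * y' s))) y -
    y s *
      OpProd ((List.finRange N).map (fun j =>
          fun (G : (Fin M → ℂ) → ℂ) (y' : Fin M → ℂ) =>
            G y' - a j * G (fun i => q * y' i)))
        (fun y' => Fqhyp q a b c y' -
          b s * Fqhyp q a b c (Function.update y' s (q * y' s))) y = 0 := by
  have hq : q ≠ 0 := norm_pos_iff.1 hq0
  rw [OpProd_map_eq_multiPowerSum hq1 (fun j => c j * q⁻¹)
      (NormBounded.one_sub_mul_qHypCoeff hq1 a c b s 1)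
      (fun y hy => by simpa only [one_mul] using Fqhyp_sub_mul_update hq1 a c b s 1 hy) _ y hy,
    OpProd_map_eq_multiPowerSum hq1 a
      (NormBounded.one_sub_mul_qHypCoeff hq1 a c b s (b s))
      (fun y hy => Fqhyp_sub_mul_update hq1 a c b s (b s) hy) _ y hy,
    sub_eq_zero]
  refine multiPowerSum_eq_mul_of_shift s (fun m hm => by simp [hm]) (fun m => ?_) y
  have hc' (j : Fin N) : c j * q⁻¹ * q ^ (∑ i, m i + 1) = q ^ (∑ i, m i) * c j := by
    rw [pow_succ]
    field_simp
  have ha' (j : Fin N) : a j * q ^ (∑ i, m i) = q ^ (∑ i, m i) * a j := mul_comm _ _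
  simp only [sum_add_single_one, hc', ha', ← List.ofFn_eq_map, List.prod_ofFn]
  simp only [Pi.add_apply, Pi.single_eq_same, one_mul, mul_comm (b s)]
  exact qHypCoeff_add_single hq1 a c b s m
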